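/- For all integers a ≥ 2 and all integers n ≥ 30, ex_Π(n, 4, 6a + 3) = Π_{2,1}(a, n). (Here 6a + 3 = C(4,2)·a + 3 = Σ_{2,1}(a,4).) -/

import Mathlib

open Finset

/-- Sum of the edge multiplicities of the multigraph `w` inside the vertex set `X`
(edges are 2-element subsets of `Fin n`). -/
def edgeSum (n : ℕ) (w : Finset (Fin n) → ℕ) (X : Finset (Fin n)) : ℕ :=
  ∑ p ∈ X.powersetCard 2, w p

/-- Product of the edge multiplicities of the multigraph `w` inside the vertex set `X`. -/
def edgeProd (n : ℕ) (w : Finset (Fin n) → ℕ) (X : Finset (Fin n)) : ℕ :=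
  ∏ p ∈ X.powersetCard 2, w p

/-- The product-degree of the vertex `v` in the multigraph `w`. -/
def pdeg (n : ℕ) (w : Finset (Fin n) → ℕ) (v : Fin n) : ℕ :=
  ∏ u ∈ Finset.univ.erase v, w {u, v}

/-- `w` is an `(n,s,q)`-graph: every `s`-set of vertices spans at most `q` edges. -/
def IsF (n s q : ℕ) (w : Finset (Fin n) → ℕ) : Prop :=
  ∀ X : Finset (Fin n), X.card = s → edgeSum n w X ≤ q

/-- `ex_Π(n,s,q)`: the maximum of the product of all edge multiplicities over
`(n,s,q)`-graphs. -/
noncomputable def exPi (n s q : ℕ) : ℕ :=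
  sSup {P | ∃ w : Finset (Fin n) → ℕ, IsF n s q w ∧ P = edgeProd n w Finset.univ}

/-- Membership in the family `T_{r,d}(a,n)`: the vertex set can be partitioned into
parts `V_0, …, V_{r-1}` (given by a labelling `f`) so that edges inside `V_0` have
multiplicity `a - d`, edges inside `V_i` (`i ≥ 1`) have multiplicity `a`, and edges
between distinct parts have multiplicity `a + 1`. -/
def InT (n r d a : ℕ) (w : Finset (Fin n) → ℕ) : Prop :=
  ∃ f : Fin n → ℕ, (∀ v, f v < r) ∧
    ∀ u v : Fin n, u ≠ v →
      w {u, v} = if f u = f v then (if f u = 0 then a - d else a) else a + 1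

/-- `Σ_{r,d}(a,n)`: the maximum number of edges of a member of `T_{r,d}(a,n)`. -/
noncomputable def SigmaT (r d a n : ℕ) : ℕ :=
  sSup {e | ∃ w : Finset (Fin n) → ℕ, InT n r d a w ∧ e = edgeSum n w Finset.univ}

/-- `Π_{r,d}(a,n)`: the maximum product of edge multiplicities of a member of
`T_{r,d}(a,n)`. -/
noncomputable def PiT (r d a n : ℕ) : ℕ :=
  sSup {P | ∃ w : Finset (Fin n) → ℕ, InT n r d a w ∧ P = edgeProd n w Finset.univ}

/-- The sum of `F` over the pairs inside `X`. -/
def pairSum {V M : Type*} [DecidableEq V] [AddCommMonoid M] (F : Finset V → M)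
    (X : Finset V) : M :=
  ∑ p ∈ X.powersetCard 2, F p

section PairSum

variable {V M : Type*} [DecidableEq V] [AddCommMonoid M]

theorem pairSum_empty (F : Finset V → M) : pairSum F ∅ = 0 := by
  rw [pairSum, powersetCard_eq_empty.2 (by simp), sum_empty]

theorem pairSum_insert (F : Finset V → M) {v : V} {X : Finset V} (hv : v ∉ X) :
    pairSum F (insert v X) = pairSum F X + ∑ u ∈ X, F {v, u} := by
  unfold pairSum
  rw [powersetCard_succ_insert hv, sum_union]
  · congr 1
    rw [powersetCard_one, sum_image, sum_map]
    · rfl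
    · intro p hp q hq h
      simp only [coe_map, Set.mem_image, mem_coe] at hp hq
      obtain ⟨b, hb, rfl⟩ := hp
      obtain ⟨c, hc, rfl⟩ := hq
      have hb' : v ≠ b := fun h => hv (h ▸ hb)
      have h1 : b ∈ insert v ({c} : Finset V) := by
        have h2 : insert v ({b} : Finset V) = insert v {c} := h
        rw [← h2]
        simp
      simp only [mem_insert, mem_singleton] at h1
      rcases h1 with h1 | h1
      · exact absurd h1.symm hb'
      · simp [h1]
  · rw [disjoint_left]
    intro p hp hq
    obtain ⟨q, -, rfl⟩ := mem_image.1 hq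
    exact hv ((mem_powersetCard.1 hp).1 (mem_insert_self _ _))

theorem pairSum_singleton (F : Finset V → M) (v : V) : pairSum F {v} = 0 := by
  rw [pairSum, powersetCard_eq_empty.2 (by simp), sum_empty]

theorem pairSum_erase (F : Finset V → M) {v : V} {X : Finset V} (hv : v ∈ X) :
    pairSum F X = pairSum F (X.erase v) + ∑ u ∈ X.erase v, F {v, u} := by
  conv_lhs => rw [← insert_erase hv]
  exact pairSum_insert F (notMem_erase v X)

theorem pairSum_union (F : Finset V → M) {B C : Finset V} (h : Disjoint B C) :
    pairSum F (B ∪ C) = pairSum F B + pairSum F C + ∑ u ∈ C, ∑ v ∈ B, F {u, v} := by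
  induction C using Finset.induction_on with
  | empty => simp [pairSum_empty]
  | insert c C hc ih =>
    rw [disjoint_insert_right] at h
    rw [union_insert, pairSum_insert F (by simp [h.1, hc]), ih h.2, pairSum_insert F hc,
      sum_insert hc, sum_union h.2]
    abel

theorem pairSum_four (F : Finset V → M) {b c d e : V} (hbc : b ≠ c) (hbd : b ≠ d)
    (hbe : b ≠ e) (hcd : c ≠ d) (hce : c ≠ e) (hde : d ≠ e) :
    pairSum F {b, c, d, e} =
      F {b, c} + F {b, d} + F {b, e} + F {c, d} + F {c, e} + F {d, e} := by
  rw [pairSum_insert F (by simp [*]), pairSum_insert F (by simp [*]),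
    pairSum_insert F (by simp [*]), pairSum_singleton, sum_insert (by simp [*]),
    sum_insert (by simp [*]),
    sum_singleton, sum_insert (by simp [*]), sum_singleton, sum_singleton]
  abel

theorem pairSum_handshake (F : Finset V → M) (X : Finset V) :
    2 • pairSum F X = ∑ v ∈ X, ∑ u ∈ X.erase v, F {v, u} := by
  induction X using Finset.induction_on with
  | empty => simp [pairSum_empty]
  | insert w X hw ih =>
    rw [pairSum_insert F hw, sum_insert hw, erase_insert hw, smul_add, ih]
    have h : ∀ v ∈ X, ∑ u ∈ (insert w X).erase v, F {v, u} =
        F {w, v} + ∑ u ∈ X.erase v, F {v, u} := by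
      intro v hv
      have hvw : w ≠ v := fun h => hw (h ▸ hv)
      rw [erase_insert_of_ne hvw, sum_insert (by simp [hw]), pair_comm]
    rw [sum_congr rfl h, sum_add_distrib, two_smul]
    abel

theorem pairSum_const (F : Finset V → M) (X : Finset V) (c : M)
    (h : ∀ u ∈ X, ∀ v ∈ X, u ≠ v → F {u, v} = c) :
    pairSum F X = (X.card.choose 2) • c := by
  unfold pairSum
  rw [← card_powersetCard, ← sum_const]
  refine sum_congr rfl fun p hp => ?_
  obtain ⟨hpX, hp2⟩ := mem_powersetCard.1 hp
  obtain ⟨u, v, huv, rfl⟩ := card_eq_two.1 hp2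
  exact h u (hpX (by simp)) v (hpX (by simp)) huv

end PairSum

theorem pairSum_mono {V M : Type*} [DecidableEq V] [AddCommMonoid M] [PartialOrder M]
    [IsOrderedAddMonoid M] {F G : Finset V → M} {X : Finset V}
    (h : ∀ u ∈ X, ∀ v ∈ X, u ≠ v → F {u, v} ≤ G {u, v}) : pairSum F X ≤ pairSum G X := by
  refine sum_le_sum fun p hp => ?_
  obtain ⟨hpX, hp2⟩ := mem_powersetCard.1 hp
  obtain ⟨u, v, huv, rfl⟩ := card_eq_two.1 hp2
  exact h u (hpX (by simp)) v (hpX (by simp)) huv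

section Sparse

variable {V : Type*} [DecidableEq V]

/-- Every four vertices of `X` span total weight at most `3`. -/
def FourSparse (x : Finset V → ℤ) (X : Finset V) : Prop :=
  ∀ Y ⊆ X, Y.card = 4 → pairSum x Y ≤ 3

/-- The vertices of `X` joined to `v` by a pair of weight `1`. -/
def plusNbrs (x : Finset V → ℤ) (X : Finset V) (v : V) : Finset V :=
  {u ∈ X.erase v | x {v, u} = 1}

/-- The vertices of `X` joined to `v` by a pair of negative weight. -/
def negNbrs (x : Finset V → ℤ) (X : Finset V) (v : V) : Finset V :=
  {u ∈ X.erase v | x {v, u} < 0}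

/-- The vertices of `X` joined to `v` by a pair of weight `0`. -/
def zeroNbrs (x : Finset V → ℤ) (X : Finset V) (v : V) : Finset V :=
  {u ∈ X.erase v | x {v, u} = 0}

variable {x : Finset V → ℤ} {X : Finset V}

theorem FourSparse.mono (h : FourSparse x X) {Y : Finset V} (hY : Y ⊆ X) : FourSparse x Y :=
  fun Z hZ => h Z (hZ.trans hY)

theorem FourSparse.four (h : FourSparse x X) {b c d e : V} (hb : b ∈ X) (hc : c ∈ X)
    (hd : d ∈ X) (he : e ∈ X) (hbc : b ≠ c) (hbd : b ≠ d) (hbe : b ≠ e) (hcd : c ≠ d)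
    (hce : c ≠ e) (hde : d ≠ e) :
    x {b, c} + x {b, d} + x {b, e} + x {c, d} + x {c, e} + x {d, e} ≤ 3 := by
  rw [← pairSum_four x hbc hbd hbe hcd hce hde]
  refine h _ ?_ ?_
  · intro y hy
    simp only [mem_insert, mem_singleton] at hy
    rcases hy with rfl | rfl | rfl | rfl <;> assumption
  · rw [card_insert_of_notMem (by simp [*]), card_insert_of_notMem (by simp [*]),
      card_insert_of_notMem (by simp [*]), card_singleton]

theorem FourSparse.exists_sum_le_two_of_heavy_triangle (h : FourSparse x X) (hX : 5 ≤ X.card)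
    {a b c : V} (ha : a ∈ X) (hb : b ∈ X) (hc : c ∈ X) (hab : a ≠ b) (hac : a ≠ c) (hbc : b ≠ c)
    (hT : 3 ≤ x {a, b} + x {a, c} + x {b, c}) :
    ∃ v ∈ X, ∑ u ∈ X.erase v, x {v, u} ≤ 2 := by
  by_contra! hcon
  have h1 := hcon a ha
  have h2 := hcon b hb
  have h3 := hcon c hc
  set R := ((X.erase a).erase b).erase c with hR
  have hcR : R.card + 3 = X.card := by
    rw [hR, card_erase_of_mem (mem_erase.2 ⟨hbc.symm, mem_erase.2 ⟨hac.symm, hc⟩⟩),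
      card_erase_of_mem (mem_erase.2 ⟨hab.symm, hb⟩), card_erase_of_mem ha]
    omega
  have e1 : X.erase a = insert b (insert c R) := by
    ext u; simp only [hR, mem_erase, mem_insert]; grind
  have e2 : X.erase b = insert a (insert c R) := by
    ext u; simp only [hR, mem_erase, mem_insert]; grind
  have e3 : X.erase c = insert a (insert b R) := by
    ext u; simp only [hR, mem_erase, mem_insert]; grind
  have haR : a ∉ R := by simp [hR]
  have hbR : b ∉ R := by simp [hR]
  have hcR' : c ∉ R := by simp [hR]
  rw [e1, sum_insert (by simp [hbc, hbR]), sum_insert hcR'] at h1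
  rw [e2, sum_insert (by simp [hac, haR]), sum_insert hcR', pair_comm b a] at h2
  rw [e3, sum_insert (by simp [hab, haR]), sum_insert hbR, pair_comm c a, pair_comm c b] at h3
  have hs : ∑ u ∈ R, (x {a, u} + x {b, u} + x {c, u}) ≤
      ∑ u ∈ R, (3 - (x {a, b} + x {a, c} + x {b, c})) := by
    refine sum_le_sum fun u hu => ?_
    have huX : u ∈ X := by simp only [hR, mem_erase] at hu; tauto
    have := h.four ha hb hc huX hab hac (ne_of_mem_of_not_mem hu haR).symm hbc
      (ne_of_mem_of_not_mem hu hbR).symm (ne_of_mem_of_not_mem hu hcR').symm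
    linarith
  rw [sum_add_distrib, sum_add_distrib, sum_const, nsmul_eq_mul] at hs
  have hR2 : (2 : ℤ) ≤ (R.card : ℤ) := by omega
  nlinarith

theorem exists_sum_le_two_of_heavy_pair (hX : 4 ≤ X.card)
    (hT : ∀ a ∈ X, ∀ b ∈ X, ∀ c ∈ X, a ≠ b → a ≠ c → b ≠ c →
      x {a, b} + x {a, c} + x {b, c} ≤ 2)
    {a b : V} (ha : a ∈ X) (hb : b ∈ X) (hab : a ≠ b) (hE : 2 ≤ x {a, b}) :
    ∃ v ∈ X, ∑ u ∈ X.erase v, x {v, u} ≤ 2 := by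
  by_contra! hcon
  have h1 := hcon a ha
  have h2 := hcon b hb
  set R := (X.erase a).erase b with hR
  have hcR : R.card + 2 = X.card := by
    rw [hR, card_erase_of_mem (mem_erase.2 ⟨hab.symm, hb⟩), card_erase_of_mem ha]
    omega
  have e1 : X.erase a = insert b R := by
    ext u; simp only [hR, mem_erase, mem_insert]; grind
  have e2 : X.erase b = insert a R := by
    ext u; simp only [hR, mem_erase, mem_insert]; grind
  have haR : a ∉ R := by simp [hR]
  have hbR : b ∉ R := by simp [hR]
  rw [e1, sum_insert hbR] at h1
  rw [e2, sum_insert haR, pair_comm b a] at h2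
  have hs : ∑ u ∈ R, (x {a, u} + x {b, u}) ≤ ∑ u ∈ R, (2 - x {a, b}) := by
    refine sum_le_sum fun u hu => ?_
    have huX : u ∈ X := by simp only [hR, mem_erase] at hu; tauto
    have := hT a ha b hb u huX hab (ne_of_mem_of_not_mem hu haR).symm
      (ne_of_mem_of_not_mem hu hbR).symm
    linarith
  rw [sum_add_distrib, sum_const, nsmul_eq_mul] at hs
  have hR2 : (2 : ℤ) ≤ (R.card : ℤ) := by omega
  nlinarith

theorem mem_plusNbrs {u v : V} : u ∈ plusNbrs x X v ↔ u ≠ v ∧ u ∈ X ∧ x {v, u} = 1 := by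
  simp [plusNbrs, and_assoc]

theorem mem_negNbrs {u v : V} : u ∈ negNbrs x X v ↔ u ≠ v ∧ u ∈ X ∧ x {v, u} < 0 := by
  simp [negNbrs, and_assoc]

theorem mem_zeroNbrs {u v : V} : u ∈ zeroNbrs x X v ↔ u ≠ v ∧ u ∈ X ∧ x {v, u} = 0 := by
  simp [zeroNbrs, and_assoc]

theorem card_nbrs (hle : ∀ u ∈ X, ∀ v ∈ X, u ≠ v → x {u, v} ≤ 1) {v : V} (hv : v ∈ X) :
    (plusNbrs x X v).card + (negNbrs x X v).card + (zeroNbrs x X v).card + 1 = X.card := by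
  have h1 : Disjoint (plusNbrs x X v) (negNbrs x X v) := by
    rw [disjoint_left]; intro u; rw [mem_plusNbrs, mem_negNbrs]; omega
  have h2 : Disjoint (plusNbrs x X v ∪ negNbrs x X v) (zeroNbrs x X v) := by
    rw [disjoint_left]; intro u; rw [mem_union, mem_plusNbrs, mem_negNbrs, mem_zeroNbrs]; omega
  rw [← card_union_of_disjoint h1, ← card_union_of_disjoint h2, ← card_erase_add_one hv]
  congr 2
  ext u
  rw [mem_union, mem_union, mem_plusNbrs, mem_negNbrs, mem_zeroNbrs, mem_erase]
  constructor
  · tauto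
  · rintro ⟨huv, hu⟩
    have := hle v hv u hu huv.symm
    rcases lt_trichotomy (x {v, u}) 0 with h | h | h
    · tauto
    · tauto
    · have : x {v, u} = 1 := by omega
      tauto

/-- Two `1`-neighbours of `v` that are both joined by weight `1` to a vertex `y` joined to `v` by
weight `0` span a pair of negative weight. -/
theorem FourSparse.neg_of_zero (h : FourSparse x X) {v y z z' : V} (hv : v ∈ X)
    (hy : y ∈ zeroNbrs x X v) (hz : z ∈ plusNbrs x X v) (hz' : z' ∈ plusNbrs x X v)
    (hzz' : z ≠ z') (hzy : x {z, y} = 1) (hz'y : x {z', y} = 1) : x {z, z'} < 0 := by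
  rw [mem_plusNbrs] at hz hz'
  rw [mem_zeroNbrs] at hy
  have hyz : y ≠ z := by rintro rfl; omega
  have hyz' : y ≠ z' := by rintro rfl; omega
  have := h.four hv hy.2.1 hz.2.1 hz'.2.1 hy.1.symm hz.1.symm hz'.1.symm hyz hyz' hzz'
  rw [pair_comm y z, pair_comm y z'] at this
  omega

theorem FourSparse.card_sub_one_le (h : FourSparse x X) {v y z : V} (hv : v ∈ X)
    (hy : y ∈ zeroNbrs x X v) (hz : z ∈ plusNbrs x X v) (hzy : x {z, y} = 1) :
    #{z' ∈ plusNbrs x X v | x {z', y} = 1} ≤ (negNbrs x X z).card + 1 := by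
  have hmem : z ∈ ({z' ∈ plusNbrs x X v | x {z', y} = 1} : Finset V) := by simp [hz, hzy]
  rw [← card_erase_add_one hmem]
  refine Nat.succ_le_succ (card_le_card fun z' hz' => ?_)
  rw [mem_erase, mem_filter] at hz'
  exact mem_negNbrs.2 ⟨hz'.1, (mem_plusNbrs.1 hz'.2.1).2.1,
    h.neg_of_zero hv hy hz hz'.2.1 hz'.1.symm hzy hz'.2.2⟩

theorem card_plusNbrs_le (hle : ∀ u ∈ X, ∀ v ∈ X, u ≠ v → x {u, v} ≤ 1)
    (hT : ∀ a ∈ X, ∀ b ∈ X, ∀ c ∈ X, a ≠ b → a ≠ c → b ≠ c →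
      x {a, b} + x {a, c} + x {b, c} ≤ 2)
    {v z : V} (hv : v ∈ X) (hz : z ∈ plusNbrs x X v) :
    (plusNbrs x X z).card ≤
      1 + (negNbrs x X v).card + #{y ∈ zeroNbrs x X v | x {z, y} = 1} := by
  have hsub : plusNbrs x X z ⊆
      insert v (negNbrs x X v ∪ {y ∈ zeroNbrs x X v | x {z, y} = 1}) := by
    intro u hu
    rw [mem_plusNbrs] at hu hz
    rw [mem_insert, mem_union, mem_filter, mem_negNbrs, mem_zeroNbrs]
    by_cases huv : u = v
    · exact Or.inl huv
    · have h1 := hle v hv u hu.2.1 (Ne.symm huv)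
      have h2 := hT v hv z hz.2.1 u hu.2.1 hz.1.symm (Ne.symm huv) hu.1.symm
      rcases lt_trichotomy (x {v, u}) 0 with h | h | h
      · tauto
      · tauto
      · omega
  have := (card_le_card hsub).trans (card_insert_le _ _)
  have := card_union_le (negNbrs x X v) {y ∈ zeroNbrs x X v | x {z, y} = 1}
  omega

theorem eq_of_degree_count {d e j m q : ℕ} (he : 1 ≤ e)
    (h : d * e + (j + 1) * j ≤ m * (j + 1)) (hm : m + 1 ≤ 3 * e) (hd : e + q + (j + 1) ≤ d) :
    e = j + 1 ∧ q = 0 ∧ d + j ≤ m := by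
  have h1 := Nat.mul_le_mul_right e hd
  have h2 := Nat.mul_le_mul_right (j + 1) hm
  have hsq : ((e : ℤ) - (j + 1)) ^ 2 + e * q ≤ 0 := by
    zify at h h1 h2
    linarith
  have heq : (q : ℤ) ≤ e * q := by
    exact_mod_cast Nat.le_mul_of_pos_left q he
  have hsq0 := sq_nonneg ((e : ℤ) - (j + 1))
  have hej : (e : ℤ) - (j + 1) = 0 := by
    rw [← sq_eq_zero_iff]
    linarith [Int.natCast_nonneg q]
  obtain rfl : e = j + 1 := by omega
  refine ⟨rfl, by omega, ?_⟩
  have : (d + j) * (j + 1) ≤ m * (j + 1) := by linarith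
  exact Nat.le_of_mul_le_mul_right this (Nat.succ_pos j)

theorem FourSparse.not_large_degrees (h : FourSparse x X) (hne : X.Nonempty)
    (hle : ∀ u ∈ X, ∀ v ∈ X, u ≠ v → x {u, v} ≤ 1)
    (hT : ∀ a ∈ X, ∀ b ∈ X, ∀ c ∈ X, a ≠ b → a ≠ c → b ≠ c →
      x {a, b} + x {a, c} + x {b, c} ≤ 2)
    {k : ℕ} (hk : 2 ≤ k) (hXk : X.card < 4 * k + 2)
    (hdeg : ∀ v ∈ X, k + 1 + (negNbrs x X v).card ≤ (plusNbrs x X v).card)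
    (hzero : ∀ v ∈ X, (zeroNbrs x X v).card + 3 * (negNbrs x X v).card < 3 * k) : False := by
  obtain ⟨v, hv, hmax⟩ := exists_max_image X (fun v => (plusNbrs x X v).card) hne
  have hcard := card_nbrs hle hv
  have hd := hdeg v hv
  have hm := hzero v hv
  set A := plusNbrs x X v with hA
  set M := zeroNbrs x X v with hM
  set q := (negNbrs x X v).card with hq
  obtain ⟨e, he⟩ : ∃ e, k = e + q := ⟨k - q, by omega⟩
  have hs : ∀ z ∈ A, e + (negNbrs x X z).card ≤ #{y ∈ M | x {z, y} = 1} := by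
    intro z hz
    have h1 := card_plusNbrs_le hle hT hv hz
    have h2 := hdeg z (mem_plusNbrs.1 hz).2.1
    rw [← hM] at h1
    omega
  obtain ⟨z₀, hz₀⟩ : A.Nonempty := card_pos.1 (by omega)
  obtain ⟨y₀, hy₀⟩ : ({y ∈ M | x {z₀, y} = 1} : Finset V).Nonempty :=
    card_pos.1 (by have := hs z₀ hz₀; omega)
  rw [mem_filter] at hy₀
  obtain ⟨y, hy, hymax⟩ := exists_max_image M (fun y => #{z ∈ A | x {z, y} = 1}) ⟨y₀, hy₀.1⟩
  set Z : Finset V := {z ∈ A | x {z, y} = 1} with hZ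
  have hJ : 1 ≤ Z.card := by
    refine le_trans ?_ (hymax y₀ hy₀.1)
    exact card_pos.2 ⟨z₀, mem_filter.2 ⟨hz₀, hy₀.2⟩⟩
  have hneg : ∀ z ∈ Z, Z.card ≤ (negNbrs x X z).card + 1 := fun z hz =>
    h.card_sub_one_le hv hy (mem_filter.1 hz).1 (mem_filter.1 hz).2
  have hdJ : k + Z.card ≤ A.card := by
    obtain ⟨z, hz⟩ := card_pos.1 hJ
    have hzX : z ∈ X := (mem_plusNbrs.1 (mem_filter.1 hz).1).2.1
    have h1 := hmax z hzX
    have h2 := hneg z hz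
    have h3 := hdeg z hzX
    omega
  have hcount : ∑ z ∈ A, #{y ∈ M | x {z, y} = 1} = ∑ y ∈ M, #{z ∈ A | x {z, y} = 1} :=
    sum_card_bipartiteAbove_eq_sum_card_bipartiteBelow (fun z y => x {z, y} = 1)
  have hup : ∑ y ∈ M, #{z ∈ A | x {z, y} = 1} ≤ M.card * Z.card := by
    rw [← smul_eq_mul]
    exact sum_le_card_nsmul _ _ _ hymax
  have hlow : A.card * e + Z.card * (Z.card - 1) ≤ ∑ z ∈ A, #{y ∈ M | x {z, y} = 1} := by
    have h1 : ∑ z ∈ A, (e + if x {z, y} = 1 then Z.card - 1 else 0) ≤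
        ∑ z ∈ A, #{y ∈ M | x {z, y} = 1} := by
      refine sum_le_sum fun z hz => ?_
      have h2 := hs z hz
      split_ifs with hzy
      · have := hneg z (mem_filter.2 ⟨hz, hzy⟩)
        omega
      · omega
    rwa [sum_add_distrib, ← sum_filter, sum_const, sum_const, smul_eq_mul, smul_eq_mul] at h1
  obtain ⟨j, hj⟩ : ∃ j, Z.card = j + 1 := ⟨Z.card - 1, by omega⟩
  have hmain : A.card * e + (j + 1) * j ≤ M.card * (j + 1) := by
    have := hlow.trans (hcount.trans_le hup)
    rwa [hj, Nat.add_sub_cancel] at this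
  rw [hj] at hdJ
  generalize A.card = d at *
  generalize M.card = m at *
  obtain ⟨h1, h2, h3⟩ := eq_of_degree_count (q := q) (by omega) hmain (by omega) (by omega)
  omega

end Sparse

section Capped

variable {V : Type*} [DecidableEq V]

/-- The concave function of an integer weight that has slope `ρ` on negative weights and slope `1`
on positive ones. -/
noncomputable def cap (ρ : ℝ) (t : ℤ) : ℝ := min (t : ℝ) (ρ * t)

/-- The total weight on `n` vertices of the configuration in which the pairs inside a `k`-set have
weight `-ρ`, the pairs inside its complement weight `0`, and the remaining pairs weight `1`. -/
noncomputable def bipValue (ρ : ℝ) (n k : ℕ) : ℝ := k * (n - k) - ρ * (k * (k - 1) / 2)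

variable {x : Finset V → ℤ} {X : Finset V} {ρ : ℝ}

theorem cap_le (t : ℤ) : cap ρ t ≤ t := min_le_left _ _

theorem cap_le_indicator (hρ : 0 ≤ ρ) {t : ℤ} (ht : t ≤ 1) :
    cap ρ t ≤ (if t = 1 then 1 else 0) - ρ * (if t < 0 then 1 else 0) := by
  rcases lt_trichotomy t 0 with h | rfl | h
  · rw [if_neg (by omega), if_pos h]
    have : (t : ℝ) ≤ -1 := by exact_mod_cast (by omega : t ≤ -1)
    refine (min_le_right _ _).trans ?_
    nlinarith
  · simp [cap]
  · obtain rfl : t = 1 := by omega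
    simpa using cap_le 1

theorem cap_nonpos {t : ℤ} (ht : t ≤ 0) : cap ρ t ≤ 0 :=
  (cap_le t).trans (by exact_mod_cast ht)

theorem cap_le_neg (hρ : 0 ≤ ρ) {t : ℤ} (ht : t < 0) : cap ρ t ≤ -ρ := by
  have := cap_le_indicator hρ (t := t) (by omega)
  rwa [if_neg (by omega), if_pos ht, mul_one, zero_sub] at this

theorem pairSum_cap_le (x : Finset V → ℤ) (X : Finset V) :
    pairSum (fun p => cap ρ (x p)) X ≤ (pairSum x X : ℤ) := by
  unfold pairSum
  push_cast
  exact sum_le_sum fun p _ => cap_le _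

theorem sum_cap_le_card (hρ : 0 ≤ ρ) (hle : ∀ u ∈ X, ∀ v ∈ X, u ≠ v → x {u, v} ≤ 1) {v : V}
    (hv : v ∈ X) :
    ∑ u ∈ X.erase v, cap ρ (x {v, u}) ≤ (plusNbrs x X v).card - ρ * (negNbrs x X v).card := by
  calc ∑ u ∈ X.erase v, cap ρ (x {v, u})
      ≤ ∑ u ∈ X.erase v, ((if x {v, u} = 1 then 1 else 0) -
          ρ * (if x {v, u} < 0 then 1 else 0)) := by
        refine sum_le_sum fun u hu => cap_le_indicator hρ ?_
        exact hle v hv u (mem_of_mem_erase hu) (ne_of_mem_erase hu).symm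
    _ = (plusNbrs x X v).card - ρ * (negNbrs x X v).card := by
        rw [sum_sub_distrib, ← mul_sum, sum_boole, sum_boole]
        rfl

theorem pairSum_three {M : Type*} [AddCommMonoid M] (F : Finset V → M) {a b c : V} (hab : a ≠ b)
    (hac : a ≠ c) (hbc : b ≠ c) : pairSum F {a, b, c} = F {a, b} + F {a, c} + F {b, c} := by
  rw [pairSum_insert F (by simp [*]), pairSum_insert F (by simp [*]), pairSum_singleton,
    sum_insert (by simp [*]), sum_singleton, sum_singleton]
  abel

theorem pairSum_two {M : Type*} [AddCommMonoid M] (F : Finset V → M) {a b : V} (hab : a ≠ b) :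
    pairSum F {a, b} = F {a, b} := by
  rw [pairSum_insert F (by simp [*]), pairSum_singleton, sum_singleton, zero_add]

theorem FourSparse.pairSum_le_of_heavy_triangle (h : FourSparse x X) {T T' : Finset V}
    (hX : X = T ∪ T') (hd : Disjoint T T') (hT : T.card = 3) (hT' : T'.card = 3)
    (h3 : 3 ≤ pairSum x T) (hle : pairSum x T' ≤ pairSum x T) : pairSum x X ≤ 6 := by
  have hcross : ∑ u ∈ T', ∑ v ∈ T, x {u, v} ≤ ∑ u ∈ T', (3 - pairSum x T) := by
    refine sum_le_sum fun u hu => ?_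
    have huT : u ∉ T := disjoint_right.1 hd hu
    have := h (insert u T)
      (insert_subset (hX ▸ mem_union_right _ hu) (hX ▸ subset_union_left))
      (by rw [card_insert_of_notMem huT, hT])
    rw [pairSum_insert x huT] at this
    linarith
  rw [sum_const, hT', nsmul_eq_mul] at hcross
  rw [hX, pairSum_union x hd]
  push_cast at hcross
  linarith

theorem FourSparse.pairSum_le_of_heavy_edge (h : FourSparse x X) (hX : X.card = 6)
    (hT : ∀ a ∈ X, ∀ b ∈ X, ∀ c ∈ X, a ≠ b → a ≠ c → b ≠ c →
      x {a, b} + x {a, c} + x {b, c} ≤ 2)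
    {a b : V} (ha : a ∈ X) (hb : b ∈ X) (hab : a ≠ b) (hE : 2 ≤ x {a, b}) : pairSum x X ≤ 6 := by
  have hsub : ({a, b} : Finset V) ⊆ X := insert_subset ha (singleton_subset_iff.2 hb)
  have hcard : (X \ {a, b}).card = 4 := by
    rw [card_sdiff_of_subset hsub, card_pair hab, hX]
  have hcross : ∑ u ∈ X \ {a, b}, ∑ v ∈ {a, b}, x {u, v} ≤ ∑ u ∈ X \ {a, b}, (2 - x {a, b}) := by
    refine sum_le_sum fun u hu => ?_
    rw [mem_sdiff, mem_insert, mem_singleton, not_or] at hu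
    have := hT u hu.1 a ha b hb hu.2.1 hu.2.2 hab
    rw [sum_pair hab]
    linarith
  rw [sum_const, hcard, nsmul_eq_mul] at hcross
  have h4 := h _ sdiff_subset hcard
  rw [← union_sdiff_of_subset hsub, pairSum_union x disjoint_sdiff, pairSum_two x hab]
  push_cast at hcross
  linarith

theorem plus_pair_nonpos
    (hT : ∀ a ∈ X, ∀ b ∈ X, ∀ c ∈ X, a ≠ b → a ≠ c → b ≠ c →
      x {a, b} + x {a, c} + x {b, c} ≤ 2)
    {v a b : V} (hv : v ∈ X) (ha : a ∈ plusNbrs x X v) (hb : b ∈ plusNbrs x X v) (hab : a ≠ b) :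
    x {a, b} ≤ 0 := by
  rw [mem_plusNbrs] at ha hb
  have := hT v hv a ha.2.1 b hb.2.1 ha.1.symm hb.1.symm hab
  omega

theorem pairSum_cap_plusNbrs_le (hρ : 0 ≤ ρ)
    (hT : ∀ a ∈ X, ∀ b ∈ X, ∀ c ∈ X, a ≠ b → a ≠ c → b ≠ c →
      x {a, b} + x {a, c} + x {b, c} ≤ 2)
    {v : V} (hv : v ∈ X) {P : Finset V} (hP : P ⊆ plusNbrs x X v)
    (hneg : ∀ z ∈ P, ∀ z' ∈ P, z ≠ z' → x {z, z'} < 0) :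
    pairSum (fun p => cap ρ (x p)) (plusNbrs x X v) ≤
      -ρ * (P.card * (P.card - 1) / 2) := by
  have hsplit : pairSum (fun p => cap ρ (x p)) (plusNbrs x X v) ≤
      pairSum (fun p => cap ρ (x p)) P := by
    refine sum_le_sum_of_subset_of_nonpos' (powersetCard_mono hP) fun p hp _ => ?_
    obtain ⟨hpA, hp2⟩ := mem_powersetCard.1 hp
    obtain ⟨a, b, hab, rfl⟩ := card_eq_two.1 hp2
    exact cap_nonpos (plus_pair_nonpos hT hv (hpA (by simp)) (hpA (by simp)) hab)
  refine hsplit.trans ?_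
  have h1 : pairSum (fun p => cap ρ (x p)) P ≤ pairSum (fun _ => -ρ) P :=
    pairSum_mono fun u hu w hw huw => cap_le_neg hρ (hneg u hu w hw huw)
  refine h1.trans_eq ?_
  rw [pairSum_const _ P (-ρ) fun _ _ _ _ _ => rfl, nsmul_eq_mul, Nat.cast_choose_two]
  ring

theorem sum_cap_le_card_filter (hρ : 0 ≤ ρ) {A : Finset V} {y : V}
    (hle : ∀ u ∈ A, x {y, u} ≤ 1) :
    ∑ u ∈ A, cap ρ (x {y, u}) ≤ (#{u ∈ A | x {u, y} = 1} : ℝ) := by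
  rw [← sum_boole]
  refine sum_le_sum fun u hu => ?_
  rw [pair_comm u y]
  have := cap_le_indicator hρ (hle u hu)
  have h2 : 0 ≤ ρ * (if x {y, u} < 0 then 1 else 0 : ℝ) := by split_ifs <;> simp [hρ]
  linarith

/-- Decomposition of the capped weight along a vertex `v`, its `1`-neighbourhood, and the rest. -/
theorem pairSum_cap_le_of_plusNbrs (hρ : 0 ≤ ρ)
    (hle : ∀ u ∈ X, ∀ v ∈ X, u ≠ v → x {u, v} ≤ 1) {v : V} (hv : v ∈ X) {R : Finset V}
    (hR : R = X.erase v \ plusNbrs x X v) :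
    pairSum (fun p => cap ρ (x p)) X ≤
      (plusNbrs x X v).card + pairSum (fun p => cap ρ (x p)) (plusNbrs x X v) +
        pairSum (fun p => cap ρ (x p)) R +
        ∑ y ∈ R, (cap ρ (x {v, y}) + #{u ∈ plusNbrs x X v | x {u, y} = 1}) := by
  have hsub : plusNbrs x X v ⊆ X.erase v := filter_subset _ _
  have hun : X.erase v = plusNbrs x X v ∪ R := by rw [hR, union_sdiff_of_subset hsub]
  have hdis : Disjoint (plusNbrs x X v) R := by rw [hR]; exact disjoint_sdiff
  have hcross : ∑ y ∈ R, ∑ u ∈ plusNbrs x X v, cap ρ (x {y, u}) ≤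
      ∑ y ∈ R, (#{u ∈ plusNbrs x X v | x {u, y} = 1} : ℝ) := by
    refine sum_le_sum fun y hy => sum_cap_le_card_filter hρ fun u hu => ?_
    have hyX : y ∈ X := by rw [hR, mem_sdiff, mem_erase] at hy; exact hy.1.2
    exact hle y hyX u (mem_plusNbrs.1 hu).2.1 (ne_of_mem_of_not_mem hu
      (disjoint_right.1 hdis hy)).symm
  have hplus : ∑ u ∈ plusNbrs x X v, cap ρ (x {v, u}) ≤ (plusNbrs x X v).card := by
    rw [card_eq_sum_ones, Nat.cast_sum]
    refine sum_le_sum fun u hu => (cap_le _).trans ?_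
    rw [(mem_plusNbrs.1 hu).2.2]
    simp
  rw [pairSum_erase _ hv, hun, pairSum_union _ hdis, sum_union hdis, sum_add_distrib]
  linarith

theorem FourSparse.pairSum_cap_plusNbrs_le_of_nonneg (h : FourSparse x X) (hρ : 0 ≤ ρ)
    (hT : ∀ a ∈ X, ∀ b ∈ X, ∀ c ∈ X, a ≠ b → a ≠ c → b ≠ c →
      x {a, b} + x {a, c} + x {b, c} ≤ 2)
    {v y : V} (hv : v ∈ X) (hy : y ∈ zeroNbrs x X v) {p : ℕ}
    (hp : #{u ∈ plusNbrs x X v | x {u, y} = 1} = p) :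
    pairSum (fun p => cap ρ (x p)) (plusNbrs x X v) ≤ -ρ * (p * (p - 1) / 2) := by
  subst hp
  refine pairSum_cap_plusNbrs_le hρ hT hv (filter_subset _ _) fun z hz z' hz' hzz' => ?_
  rw [mem_filter] at hz hz'
  exact h.neg_of_zero hv hy hz.1 hz'.1 hzz' hz.2 hz'.2

theorem neg_or_mem_zeroNbrs (hle : ∀ u ∈ X, ∀ v ∈ X, u ≠ v → x {u, v} ≤ 1) {v y : V}
    (hv : v ∈ X) (hy : y ∈ X.erase v \ plusNbrs x X v) :
    x {v, y} < 0 ∨ y ∈ zeroNbrs x X v := by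
  rw [mem_sdiff, mem_erase, mem_plusNbrs] at hy
  have := hle v hv y hy.1.2 hy.1.1.symm
  rw [mem_zeroNbrs]
  rcases lt_trichotomy (x {v, y}) 0 with h | h | h
  · exact Or.inl h
  · exact Or.inr ⟨hy.1.1, hy.1.2, h⟩
  · exact absurd ⟨hy.1.1, hy.1.2, by omega⟩ hy.2

theorem FourSparse.pairSum_cap_le_of_card_six (h : FourSparse x X) (hX : X.card = 6)
    (hρ1 : 1 ≤ ρ) (hρ2 : ρ ≤ 2) : pairSum (fun p => cap ρ (x p)) X ≤ 8 - ρ := by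
  have hρ : 0 ≤ ρ := by linarith
  have hsix : pairSum x X ≤ 6 → pairSum (fun p => cap ρ (x p)) X ≤ 8 - ρ := by
    intro h6
    have h6' : ((pairSum x X : ℤ) : ℝ) ≤ 6 := by exact_mod_cast h6
    linarith [pairSum_cap_le (ρ := ρ) x X]
  by_cases hT : ∀ a ∈ X, ∀ b ∈ X, ∀ c ∈ X, a ≠ b → a ≠ c → b ≠ c →
      x {a, b} + x {a, c} + x {b, c} ≤ 2
  swap
  · push Not at hT
    obtain ⟨a, ha, b, hb, c, hc, hab, hac, hbc, h3⟩ := hT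
    have hsub : ({a, b, c} : Finset V) ⊆ X :=
      insert_subset ha (insert_subset hb (singleton_subset_iff.2 hc))
    have hc3 : ({a, b, c} : Finset V).card = 3 := card_eq_three.2 ⟨a, b, c, hab, hac, hbc, rfl⟩
    have hc3' : (X \ {a, b, c}).card = 3 := by rw [card_sdiff_of_subset hsub, hc3, hX]
    rw [← pairSum_three x hab hac hbc] at h3
    have hun := (union_sdiff_of_subset hsub).symm
    rcases le_total (pairSum x (X \ {a, b, c})) (pairSum x {a, b, c}) with hle | hle
    · exact hsix (h.pairSum_le_of_heavy_triangle hun disjoint_sdiff hc3 hc3' (by omega) hle)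
    · exact hsix (h.pairSum_le_of_heavy_triangle (hun.trans (union_comm _ _)) sdiff_disjoint
        hc3' hc3 (by omega) hle)
  by_cases hle : ∀ u ∈ X, ∀ v ∈ X, u ≠ v → x {u, v} ≤ 1
  swap
  · push Not at hle
    obtain ⟨a, ha, b, hb, hab, h2⟩ := hle
    exact hsix (h.pairSum_le_of_heavy_edge hX hT ha hb hab h2)
  by_cases hdeg : ∀ v ∈ X, (plusNbrs x X v).card ≤ 2
  · have h1 := pairSum_handshake (fun p => cap ρ (x p)) X
    have h2 : ∑ v ∈ X, ∑ u ∈ X.erase v, cap ρ (x {v, u}) ≤ ∑ v ∈ X, (2 : ℝ) := by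
      refine sum_le_sum fun v hv => (sum_cap_le_card hρ hle hv).trans ?_
      have : ((plusNbrs x X v).card : ℝ) ≤ 2 := by exact_mod_cast hdeg v hv
      have : 0 ≤ ρ * (negNbrs x X v).card := by positivity
      linarith
    rw [sum_const, hX, ← h1, nsmul_eq_mul, nsmul_eq_mul] at h2
    norm_num at h2
    linarith
  push Not at hdeg
  obtain ⟨v, hv, hd⟩ := hdeg
  obtain ⟨R, hR⟩ : ∃ R, R = X.erase v \ plusNbrs x X v := ⟨_, rfl⟩
  have hmain := pairSum_cap_le_of_plusNbrs hρ hle hv hR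
  have hsub : plusNbrs x X v ⊆ X.erase v := filter_subset _ _
  have hcardR : R.card + (plusNbrs x X v).card = 5 := by
    rw [hR, card_sdiff_add_card_eq_card hsub, card_erase_of_mem hv, hX]
  have hA0 : pairSum (fun p => cap ρ (x p)) (plusNbrs x X v) ≤ 0 := by
    simpa using pairSum_cap_plusNbrs_le (P := ∅) hρ hT hv (empty_subset _) (by simp)
  have hvy : ∀ y ∈ R, cap ρ (x {v, y}) ≤ -ρ ∨ (cap ρ (x {v, y}) ≤ 0 ∧ y ∈ zeroNbrs x X v) := by
    intro y hy
    rcases neg_or_mem_zeroNbrs hle hv (hR ▸ hy) with h0 | h0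
    · exact Or.inl (cap_le_neg hρ h0)
    · exact Or.inr ⟨cap_nonpos (mem_zeroNbrs.1 h0).2.2.le, h0⟩
  obtain h5 | h4 | h3 : R.card = 0 ∨ R.card = 1 ∨ R.card = 2 := by omega
  · rw [card_eq_zero] at h5
    rw [h5, card_empty] at hcardR
    rw [h5, pairSum_empty, sum_empty, show (plusNbrs x X v).card = 5 by omega] at hmain
    push_cast at hmain
    linarith
  · rw [h4] at hcardR
    obtain ⟨y, rfl⟩ := card_eq_one.1 h4
    have hP := card_filter_le (plusNbrs x X v) (fun u => x {u, y} = 1)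
    rw [sum_singleton, pairSum_singleton,
      show (plusNbrs x X v).card = 4 by omega] at hmain
    have hA := fun h0 => h.pairSum_cap_plusNbrs_le_of_nonneg hρ hT hv (y := y) h0 rfl
    have hvy := hvy y (by simp)
    generalize #{u ∈ plusNbrs x X v | x {u, y} = 1} = p at *
    have hp : p ≤ 4 := by omega
    rcases hvy with h0 | ⟨h0, h1⟩
    · have : (p : ℝ) ≤ 4 := by exact_mod_cast hp
      push_cast at hmain
      linarith
    · have hA := hA h1
      interval_cases p <;> norm_num at hA hmain <;> linarith
  · rw [h3] at hcardR
    obtain ⟨y, z, hyz, rfl⟩ := card_eq_two.1 h3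
    have hPy := card_filter_le (plusNbrs x X v) (fun u => x {u, y} = 1)
    have hPz := card_filter_le (plusNbrs x X v) (fun u => x {u, z} = 1)
    have hyX : y ∈ X := by
      have : y ∈ X.erase v \ plusNbrs x X v := hR ▸ mem_insert_self _ _
      exact mem_of_mem_erase (mem_sdiff.1 this).1
    have hzX : z ∈ X := by
      have : z ∈ X.erase v \ plusNbrs x X v := hR ▸ mem_insert_of_mem (mem_singleton_self _)
      exact mem_of_mem_erase (mem_sdiff.1 this).1
    have hyA : y ∉ plusNbrs x X v :=
      (mem_sdiff.1 (hR ▸ mem_insert_self _ _ : y ∈ X.erase v \ plusNbrs x X v)).2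
    have hzA : z ∉ plusNbrs x X v := (mem_sdiff.1 (hR ▸ mem_insert_of_mem (mem_singleton_self _) :
      z ∈ X.erase v \ plusNbrs x X v)).2
    have hyzcap : cap ρ (x {y, z}) ≤ 0 ∨ (cap ρ (x {y, z}) ≤ 1 ∧
        #{u ∈ plusNbrs x X v | x {u, y} = 1} + #{u ∈ plusNbrs x X v | x {u, z} = 1} ≤ 3) := by
      rcases le_or_gt (x {y, z}) 0 with h0 | h0
      · exact Or.inl (cap_nonpos h0)
      · have hyz1 : x {y, z} = 1 := by have := hle y hyX z hzX hyz; omega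
        refine Or.inr ⟨by simpa [hyz1] using cap_le (ρ := ρ) (x {y, z}), ?_⟩
        rw [← card_union_of_disjoint]
        · refine (card_le_card (union_subset (filter_subset _ _) (filter_subset _ _))).trans ?_
          omega
        · rw [disjoint_left]
          intro u huy huz
          rw [mem_filter] at huy huz
          have := hT u (mem_plusNbrs.1 huy.1).2.1 y hyX z hzX (ne_of_mem_of_not_mem huy.1 hyA)
            (ne_of_mem_of_not_mem huy.1 hzA) hyz
          omega
    rw [sum_pair hyz, pairSum_two _ hyz, show (plusNbrs x X v).card = 3 by omega] at hmain
    have hAy := fun h0 => h.pairSum_cap_plusNbrs_le_of_nonneg hρ hT hv (y := y) h0 rfl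
    have hAz := fun h0 => h.pairSum_cap_plusNbrs_le_of_nonneg hρ hT hv (y := z) h0 rfl
    have hvy' := hvy y (by simp)
    have hvz' := hvy z (by simp)
    generalize #{u ∈ plusNbrs x X v | x {u, y} = 1} = p at *
    generalize #{u ∈ plusNbrs x X v | x {u, z} = 1} = r at *
    have hp : p ≤ 3 := by omega
    have hr : r ≤ 3 := by omega
    clear * - hmain hρ1 hρ2 hp hr hA0 hyzcap hvy' hvz' hAy hAz
    have hAy' : cap ρ (x {v, y}) ≤ -ρ ∨ _ := hvy'.imp_right fun h => And.intro h.1 (hAy h.2)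
    have hAz' : cap ρ (x {v, z}) ≤ -ρ ∨ _ := hvz'.imp_right fun h => And.intro h.1 (hAz h.2)
    clear hAy hAz hvy' hvz'
    interval_cases p <;> interval_cases r <;> norm_num at hmain hAy' hAz' hyzcap <;>
      rcases hAy' with h1 | ⟨h1, h2⟩ <;> rcases hAz' with h3 | ⟨h3, h4⟩ <;>
      (try rcases hyzcap with h5 | h5) <;> linarith

end Capped

section Extremal

variable {V : Type*} [DecidableEq V] {x : Finset V → ℤ} {X : Finset V} {ρ : ℝ}

theorem bipValue_succ_left (ρ : ℝ) (n k : ℕ) : bipValue ρ (n + 1) k = bipValue ρ n k + k := by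
  unfold bipValue
  push_cast
  ring

theorem bipValue_succ_right (ρ : ℝ) (n k : ℕ) :
    bipValue ρ n (k + 1) = bipValue ρ n k + (n - 2 * k - 1 - ρ * k) := by
  unfold bipValue
  push_cast
  ring

theorem exists_argmax_bipValue (hρ1 : 1 < ρ) (hρ2 : ρ < 2) {n : ℕ} (hn : 6 ≤ n) :
    ∃ k, k ≤ n ∧ 2 ≤ k ∧ n ≤ 4 * k ∧ ∀ j ≤ n, bipValue ρ n j ≤ bipValue ρ n k := by
  obtain ⟨k, hk, hmax⟩ := exists_max_image (range (n + 1)) (bipValue ρ n) ⟨0, by simp⟩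
  have hmax' : ∀ j ≤ n, bipValue ρ n j ≤ bipValue ρ n k := fun j hj =>
    hmax j (mem_range.2 (by omega))
  have hkn : k ≤ n := by rw [mem_range] at hk; omega
  have hn' : (6 : ℝ) ≤ n := by exact_mod_cast hn
  have hk2 : 2 ≤ k := by
    by_contra! hlt
    have h2 := hmax' 2 (by omega)
    have h20 := bipValue_succ_right ρ n 0
    have h21 := bipValue_succ_right ρ n 1
    interval_cases k <;> norm_num at h2 h20 h21 <;> linarith
  refine ⟨k, hkn, hk2, ?_, hmax'⟩
  rcases hkn.eq_or_lt with rfl | hlt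
  · omega
  have h1 := hmax' (k + 1) hlt
  rw [bipValue_succ_right] at h1
  have hk2' : (2 : ℝ) ≤ k := by exact_mod_cast hk2
  have h3 : (n : ℝ) < 4 * k + 1 := by nlinarith
  have h4 : n < 4 * k + 1 := by exact_mod_cast h3
  omega

theorem FourSparse.light_of_two_lt_sum (h : FourSparse x X) (hX : 5 ≤ X.card)
    (hsum : ∀ v ∈ X, 2 < ∑ u ∈ X.erase v, x {v, u}) :
    (∀ a ∈ X, ∀ b ∈ X, ∀ c ∈ X, a ≠ b → a ≠ c → b ≠ c →
      x {a, b} + x {a, c} + x {b, c} ≤ 2) ∧ ∀ u ∈ X, ∀ v ∈ X, u ≠ v → x {u, v} ≤ 1 := by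
  have hT : ∀ a ∈ X, ∀ b ∈ X, ∀ c ∈ X, a ≠ b → a ≠ c → b ≠ c →
      x {a, b} + x {a, c} + x {b, c} ≤ 2 := by
    by_contra! hT
    obtain ⟨a, ha, b, hb, c, hc, hab, hac, hbc, h3⟩ := hT
    obtain ⟨v, hv, h2⟩ := h.exists_sum_le_two_of_heavy_triangle hX ha hb hc hab hac hbc h3
    exact h2.not_gt (hsum v hv)
  refine ⟨hT, ?_⟩
  by_contra! hle
  obtain ⟨a, ha, b, hb, hab, h2⟩ := hle
  obtain ⟨v, hv, h2⟩ := exists_sum_le_two_of_heavy_pair (by omega) hT ha hb hab h2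
  exact h2.not_gt (hsum v hv)

/-- A weighting in which every four vertices span total weight at most `3` has capped weight at
most that of some two-part configuration. -/
theorem FourSparse.exists_pairSum_cap_le (hρ1 : 1 < ρ) (hρ2 : ρ < 2) {n : ℕ} (hn : 6 ≤ n) :
    ∀ {X : Finset V}, FourSparse x X → X.card = n →
      ∃ k ≤ n, pairSum (fun p => cap ρ (x p)) X ≤ bipValue ρ n k := by
  induction n, hn using Nat.le_induction with
  | base =>
    intro X h hX
    refine ⟨2, by norm_num, (h.pairSum_cap_le_of_card_six hX hρ1.le hρ2.le).trans_eq ?_⟩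
    norm_num [bipValue]
  | succ n hn ih =>
    intro X h hX
    by_contra! hcon
    obtain ⟨K, hKn, hK2, hnK, hmax⟩ := exists_argmax_bipValue hρ1 hρ2 hn
    have hK2' : (2 : ℝ) ≤ K := by exact_mod_cast hK2
    have hdrop : ∀ v ∈ X, (K : ℝ) < ∑ u ∈ X.erase v, cap ρ (x {v, u}) ∧
        n - K - ρ * K < ∑ u ∈ X.erase v, cap ρ (x {v, u}) := by
      intro v hv
      obtain ⟨j, hj, hle⟩ := ih (h.mono (erase_subset v X)) (by rw [card_erase_of_mem hv, hX]; rfl)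
      have h1 := hcon K (by omega)
      have h2 := hcon (K + 1) (by omega)
      have h3 := hmax j hj
      rw [pairSum_erase _ hv] at h1 h2
      rw [bipValue_succ_left] at h1 h2
      rw [bipValue_succ_right] at h2
      push_cast at h2
      constructor <;> linarith
    obtain ⟨hT, hle⟩ := h.light_of_two_lt_sum (by omega) fun v hv => by
      have h4 : ∑ u ∈ X.erase v, cap ρ (x {v, u}) ≤ ∑ u ∈ X.erase v, (x {v, u} : ℝ) :=
        sum_le_sum fun u _ => cap_le _
      have h5 : (2 : ℝ) < ∑ u ∈ X.erase v, (x {v, u} : ℝ) := by linarith [(hdrop v hv).1]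
      exact_mod_cast h5
    have hcount : ∀ v ∈ X, K + 1 + (negNbrs x X v).card ≤ (plusNbrs x X v).card ∧
        (zeroNbrs x X v).card + 3 * (negNbrs x X v).card < 3 * K := by
      intro v hv
      obtain ⟨h1, h2⟩ := hdrop v hv
      have h3 := sum_cap_le_card (ρ := ρ) (by linarith) hle hv
      have h4 := card_nbrs hle hv
      rw [hX] at h4
      generalize (plusNbrs x X v).card = d at *
      generalize (negNbrs x X v).card = q at *
      generalize (zeroNbrs x X v).card = z at *
      have h4' : (d : ℝ) + q + z = n := by
        have : d + q + z = n := by omega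
        exact_mod_cast this
      have hq : (0 : ℝ) ≤ q := q.cast_nonneg
      have hz : (0 : ℝ) ≤ z := z.cast_nonneg
      have hqK : (q : ℝ) < K := by nlinarith
      constructor
      · have : (K : ℝ) + q < d := by nlinarith
        have : K + q < d := by exact_mod_cast this
        omega
      · have : (z : ℝ) + 3 * q < 3 * K := by nlinarith
        exact_mod_cast this
    exact h.not_large_degrees (card_pos.1 (by omega)) hle hT hK2 (by omega)
      (fun v hv => (hcount v hv).1) fun v hv => (hcount v hv).2

end Extremal

section Logarithm

theorem log_succ_sub_log_anti {c m : ℕ} (hc : 1 ≤ c) (hcm : c ≤ m) :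
    Real.log (m + 1) - Real.log m ≤ Real.log (c + 1) - Real.log c := by
  have hc' : (0 : ℝ) < c := by exact_mod_cast hc
  have hcm' : (c : ℝ) ≤ m := by exact_mod_cast hcm
  rw [sub_le_sub_iff, ← Real.log_mul (by positivity) hc'.ne', ← Real.log_mul (by positivity)
    (by linarith)]
  exact Real.log_le_log (by positivity) (by linarith)

/-- On positive integers the logarithm lies below its chord through `c` and `c + 1`. -/
theorem log_le_chord {c m : ℕ} (hc : 1 ≤ c) (hm : 1 ≤ m) :
    Real.log m ≤ Real.log c + (m - c) * (Real.log (c + 1) - Real.log c) := by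
  rcases le_total c m with h | h
  · induction m, h using Nat.le_induction with
    | base => simp
    | succ m h ih =>
      have := log_succ_sub_log_anti hc h
      have := ih (by omega)
      push_cast
      linarith
  · induction c, h using Nat.le_induction with
    | base => simp
    | succ c h ih =>
      have h1 := log_succ_sub_log_anti (by omega : 1 ≤ c) c.le_succ
      have h2 := ih (by omega)
      have h3 : (m : ℝ) ≤ c := by exact_mod_cast h
      push_cast at h1 ⊢
      nlinarith

/-- The ratio of the losses incurred when lowering a multiplicity from `a` to `a - 1` and
from `a + 1` to `a`. -/
noncomputable def logRatio (a : ℕ) : ℝ :=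
  (Real.log a - Real.log (a - 1)) / (Real.log (a + 1) - Real.log a)

variable {a : ℕ}

theorem log_succ_sub_log_pos (ha : 1 ≤ a) : 0 < Real.log (a + 1) - Real.log a := by
  have : (0 : ℝ) < a := by exact_mod_cast ha
  exact sub_pos.2 (Real.log_lt_log this (by linarith))

theorem log_gap_mul_logRatio (ha : 1 ≤ a) :
    (Real.log (a + 1) - Real.log a) * logRatio a = Real.log a - Real.log (a - 1) :=
  mul_div_cancel₀ _ (log_succ_sub_log_pos ha).ne'

theorem one_lt_logRatio (ha : 2 ≤ a) : 1 < logRatio a := by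
  have ha' : (2 : ℝ) ≤ a := by exact_mod_cast ha
  rw [logRatio, one_lt_div (log_succ_sub_log_pos (by omega)), sub_lt_sub_iff,
    ← Real.log_mul (by linarith) (by linarith), ← Real.log_mul (by linarith) (by linarith)]
  exact Real.log_lt_log (mul_pos (by linarith) (by linarith)) (by linarith)

theorem logRatio_lt_two (ha : 2 ≤ a) : logRatio a < 2 := by
  have ha' : (2 : ℝ) ≤ a := by exact_mod_cast ha
  rw [logRatio, div_lt_iff₀ (log_succ_sub_log_pos (by omega))]
  have h : Real.log ((a : ℝ) ^ 3) < Real.log ((a - 1) * (a + 1 : ℝ) ^ 2) :=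
    Real.log_lt_log (by positivity) (by nlinarith)
  rw [Real.log_mul (by linarith) (by positivity), Real.log_pow, Real.log_pow] at h
  push_cast at h
  linarith

theorem log_le_cap (ha : 2 ≤ a) {m : ℕ} (hm : 1 ≤ m) :
    Real.log m ≤
      Real.log a + (Real.log (a + 1) - Real.log a) * cap (logRatio a) ((m : ℤ) - a) := by
  obtain ⟨b, rfl⟩ : ∃ b, a = b + 1 := ⟨a - 1, by omega⟩
  have h1 := log_le_chord (by omega : 1 ≤ b + 1) hm
  have h2 := log_le_chord (by omega : 1 ≤ b) hm
  have h3 := log_gap_mul_logRatio (by omega : 1 ≤ b + 1)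
  rw [cap, mul_min_of_nonneg _ _ (log_succ_sub_log_pos (by omega)).le, ← mul_assoc, h3,
    ← min_add_add_left, le_min_iff]
  push_cast at h1 h2 ⊢
  rw [add_sub_cancel_right]
  constructor <;> linarith

end Logarithm

section TwoPart

/-- Multiplicity `a - 1` inside `B`, `a` inside its complement, and `a + 1` across. -/
def twoPart {V : Type*} [DecidableEq V] (a : ℕ) (B : Finset V) (p : Finset V) : ℕ :=
  if p ⊆ B then a - 1 else if Disjoint p B then a else a + 1

theorem twoPart_pair {V : Type*} [DecidableEq V] (a : ℕ) (B : Finset V) (u v : V) :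
    twoPart a B {u, v} =
      if u ∈ B then if v ∈ B then a - 1 else a + 1 else if v ∈ B then a + 1 else a := by
  unfold twoPart
  by_cases hu : u ∈ B <;> by_cases hv : v ∈ B <;>
    simp [hu, hv, insert_subset_iff, disjoint_insert_left]

variable {n a : ℕ}

theorem inT_twoPart (a : ℕ) (B : Finset (Fin n)) : InT n 2 1 a (twoPart a B) := by
  refine ⟨fun v => if v ∈ B then 0 else 1, fun v => by dsimp only; split_ifs <;> norm_num,
    fun u v _ => ?_⟩
  rw [twoPart_pair]
  by_cases hu : u ∈ B <;> by_cases hv : v ∈ B <;> simp [hu, hv]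

theorem log_edgeProd {w : Finset (Fin n) → ℕ} {X : Finset (Fin n)}
    (hw : ∀ p ∈ X.powersetCard 2, w p ≠ 0) :
    Real.log (edgeProd n w X) = pairSum (fun p => Real.log (w p)) X := by
  rw [edgeProd, pairSum, Nat.cast_prod, Real.log_prod fun p hp => by exact_mod_cast hw p hp]

theorem log_edgeProd_twoPart (ha : 2 ≤ a) (B : Finset (Fin n)) :
    Real.log (edgeProd n (twoPart a B) univ) =
      n.choose 2 * Real.log a +
        (Real.log (a + 1) - Real.log a) * bipValue (logRatio a) n B.card := by
  have hc : ((Bᶜ.card : ℕ) : ℝ) = n - B.card := by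
    rw [card_compl, Fintype.card_fin, Nat.cast_sub (by simpa using card_le_univ B)]
  have hβ := log_gap_mul_logRatio (by omega : 1 ≤ a)
  rw [log_edgeProd fun p _ => by unfold twoPart; split_ifs <;> omega, ← union_compl B,
    pairSum_union _ disjoint_compl_right,
    pairSum_const _ B (Real.log (a - 1)) fun u hu v hv _ => by
      rw [twoPart_pair, if_pos hu, if_pos hv, Nat.cast_sub (by omega), Nat.cast_one],
    pairSum_const _ Bᶜ (Real.log a) fun u hu v hv _ => by
      rw [twoPart_pair, if_neg (mem_compl.1 hu), if_neg (mem_compl.1 hv)],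
    sum_congr rfl fun u hu => sum_congr rfl fun v hv => by
      rw [twoPart_pair, if_neg (mem_compl.1 hu), if_pos hv],
    sum_const, sum_const]
  simp only [nsmul_eq_mul, Nat.cast_choose_two, hc, bipValue]
  push_cast
  linear_combination (B.card * (B.card - 1) / 2 : ℝ) * hβ

theorem FourSparse.of_isF {w : Finset (Fin n) → ℕ} (hw : IsF n 4 (6 * a + 3) w) :
    FourSparse (fun p => (w p : ℤ) - a) univ := by
  intro Y _ hY
  have h := hw Y hY
  unfold edgeSum at h
  unfold pairSum
  rw [sum_sub_distrib, sum_const, card_powersetCard, hY, show Nat.choose 4 2 = 6 from rfl,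
    nsmul_eq_mul]
  zify at h
  push_cast
  linarith

theorem IsF.of_inT (ha : 1 ≤ a) {w : Finset (Fin n) → ℕ} (hw : InT n 2 1 a w) :
    IsF n 4 (6 * a + 3) w := by
  obtain ⟨f, hf, hw⟩ := hw
  intro X hX
  obtain ⟨b, c, d, e, hbc, hbd, hbe, hcd, hce, hde, rfl⟩ := card_eq_four.1 hX
  have h := pairSum_four w hbc hbd hbe hcd hce hde
  rw [hw b c hbc, hw b d hbd, hw b e hbe, hw c d hcd, hw c e hce, hw d e hde] at h
  have hb := hf b
  have hc := hf c
  have hd := hf d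
  have he := hf e
  change pairSum w _ ≤ _
  rw [h]
  generalize f b = b' at *
  generalize f c = c' at *
  generalize f d = d' at *
  generalize f e = e' at *
  clear * - ha hb hc hd he
  interval_cases b' <;> interval_cases c' <;> interval_cases d' <;> interval_cases e' <;>
    simp <;> omega

theorem edgeProd_le_of_isF (ha : 2 ≤ a) (hn : 6 ≤ n) {w : Finset (Fin n) → ℕ}
    (hw : IsF n 4 (6 * a + 3) w) :
    ∃ B : Finset (Fin n), edgeProd n w univ ≤ edgeProd n (twoPart a B) univ := by
  by_cases h0 : ∃ p ∈ (univ : Finset (Fin n)).powersetCard 2, w p = 0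
  · obtain ⟨p, hp, h0⟩ := h0
    exact ⟨∅, (prod_eq_zero hp h0).trans_le (Nat.zero_le _)⟩
  push Not at h0
  obtain ⟨k, hk, hle⟩ := (FourSparse.of_isF hw).exists_pairSum_cap_le (one_lt_logRatio ha)
    (logRatio_lt_two ha) hn (by simp)
  obtain ⟨B, -, rfl⟩ := exists_subset_card_eq (s := (univ : Finset (Fin n))) (n := k) (by simpa)
  refine ⟨B, ?_⟩
  have hpos : ∀ {w : Finset (Fin n) → ℕ}, (∀ p ∈ univ.powersetCard 2, w p ≠ 0) →
      (0 : ℝ) < edgeProd n w univ := fun h => by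
    exact_mod_cast Nat.pos_of_ne_zero (prod_ne_zero_iff.2 h)
  have hlog : Real.log (edgeProd n w univ) ≤ Real.log (edgeProd n (twoPart a B) univ) := by
    rw [log_edgeProd h0, log_edgeProd_twoPart ha]
    calc pairSum (fun p => Real.log (w p)) univ
        ≤ pairSum (fun p => Real.log a + (Real.log (a + 1) - Real.log a) *
            cap (logRatio a) ((w p : ℤ) - a)) univ :=
          sum_le_sum fun p hp => log_le_cap ha (Nat.one_le_iff_ne_zero.2 (h0 p hp))
      _ = n.choose 2 * Real.log a + (Real.log (a + 1) - Real.log a) *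
            pairSum (fun p => cap (logRatio a) ((w p : ℤ) - a)) univ := by
          rw [pairSum, pairSum, sum_add_distrib, ← mul_sum, sum_const, card_powersetCard,
            card_univ, Fintype.card_fin, nsmul_eq_mul]
      _ ≤ _ := by gcongr; exact (log_succ_sub_log_pos (by omega)).le
  have hT : ∀ p ∈ univ.powersetCard 2, twoPart a B p ≠ 0 := fun p _ => by
    unfold twoPart; split_ifs <;> omega
  exact_mod_cast (Real.log_le_log_iff (hpos h0) (hpos hT)).1 hlog

end TwoPart

/-- Mubayi–Terry conjecture: for all integers `a ≥ 2` and `n ≥ 30`,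
`ex_Π(n, 4, 6a + 3) = Π_{2,1}(a, n)`. -/
theorem mubayi_terry (a n : ℕ) (ha : 2 ≤ a) (hn : 30 ≤ n) :
    exPi n 4 (6 * a + 3) = PiT 2 1 a n := by
  have hbdd : BddAbove {P | ∃ w : Finset (Fin n) → ℕ, InT n 2 1 a w ∧ P = edgeProd n w univ} := by
    refine ⟨(a + 1) ^ #((univ : Finset (Fin n)).powersetCard 2), ?_⟩
    rintro _ ⟨w, ⟨f, -, hw⟩, rfl⟩
    refine prod_le_pow_card _ _ _ fun p hp => ?_
    obtain ⟨u, v, huv, rfl⟩ := card_eq_two.1 (mem_powersetCard.1 hp).2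
    rw [hw u v huv]
    split_ifs <;> omega
  have hle : ∀ P ∈ {P | ∃ w : Finset (Fin n) → ℕ, IsF n 4 (6 * a + 3) w ∧ P = edgeProd n w univ},
      P ≤ PiT 2 1 a n := by
    rintro _ ⟨w, hw, rfl⟩
    obtain ⟨B, hB⟩ := edgeProd_le_of_isF ha (by omega) hw
    exact hB.trans (le_csSup hbdd ⟨_, inT_twoPart a B, rfl⟩)
  refine le_antisymm (csSup_le' hle) (csSup_le' ?_)
  rintro _ ⟨w, hw, rfl⟩
  exact le_csSup ⟨_, hle⟩ ⟨w, IsF.of_inT (by omega) hw, rfl⟩
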